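/- Suppose the finite simple graph G = (V,E) has at least six vertices, and that (G,q) is a framework in Σ which is completely full in Σ and infinitesimally rigid, and such that for every edge e ∈ E the framework (G − e, q) is not infinitesimally rigid. Then G is (3,4)-tight, i.e. |E| = 3|V| − 4 and every subgraph (V',E') of G with at least one edge satisfies |E'| ≤ 3|V'| − 4. -/

import Mathlib

open Matrix BigOperators

/-- The hypercylinder Σ in ℝ⁴. -/
def Hyp : Set (Fin 4 → ℝ) := {x | x 0 ^ 2 + x 1 ^ 2 + x 2 ^ 2 = 1}

/-- π(x)·π(y), where π : ℝ⁴ → ℝ³ drops the last coordinate. -/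
def piDot (x y : Fin 4 → ℝ) : ℝ := x 0 * y 0 + x 1 * y 1 + x 2 * y 2

/-- The Euclidean inner product on ℝ⁴. -/
def dot4 (x y : Fin 4 → ℝ) : ℝ := ∑ i, x i * y i

/-- The pair (B,c) determines an infinitesimal rigid motion η(x) = Bx + c of Σ. -/
def InTSigma (B : Matrix (Fin 4) (Fin 4) ℝ) (c : Fin 4 → ℝ) : Prop :=
  Bᵀ = -B ∧ ∀ x ∈ Hyp, piDot (B.mulVec x + c) x = 0

/-- m is an infinitesimal flex of the framework (G,q) in Σ. -/
def IsFlex {V : Type*} (G : SimpleGraph V) (q m : V → Fin 4 → ℝ) : Prop :=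
  (∀ u v, G.Adj u v → dot4 (m u - m v) (q u - q v) = 0) ∧
    (∀ v, piDot (m v) (q v) = 0)

/-- The subframework of (G,q) on the vertex set S is full in Σ: the only
infinitesimal rigid motion of Σ vanishing at all points q v, v ∈ S, is zero. -/
def FullOn {V : Type*} (q : V → Fin 4 → ℝ) (S : Set V) : Prop :=
  ∀ (B : Matrix (Fin 4) (Fin 4) ℝ) (c : Fin 4 → ℝ), InTSigma B c →
    (∀ v ∈ S, B.mulVec (q v) + c = 0) → B = 0 ∧ c = 0

/-- The framework (G,q) is infinitesimally rigid in Σ. -/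
def InfRigid {V : Type*} (G : SimpleGraph V) (q : V → Fin 4 → ℝ) : Prop :=
  ∀ m : V → Fin 4 → ℝ, IsFlex G q m →
    ∃ (B : Matrix (Fin 4) (Fin 4) ℝ) (c : Fin 4 → ℝ), InTSigma B c ∧
      ∀ v, m v = B.mulVec (q v) + c

/-- The skew-symmetric matrix of the rotation field `x ↦ a × x` on the first three coordinates. -/
def rotMatrix (a : Fin 4 → ℝ) : Matrix (Fin 4) (Fin 4) ℝ :=
  !![0, -a 2, a 1, 0; a 2, 0, -a 0, 0; -a 1, a 0, 0, 0; 0, 0, 0, 0]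

/-- The infinitesimal rigid motion of the hypercylinder with rotation axis `(a 0, a 1, a 2)` and
axial speed `a 3`, evaluated at `x`. -/
def rigidMotion (x : Fin 4 → ℝ) : (Fin 4 → ℝ) →ₗ[ℝ] (Fin 4 → ℝ) where
  toFun a := rotMatrix a *ᵥ x + ![0, 0, 0, a 3]
  map_add' a b := by
    ext i
    fin_cases i <;> simp [rotMatrix, dotProduct, Fin.sum_univ_four] <;> ring
  map_smul' r a := by
    ext i
    fin_cases i <;> simp [rotMatrix, dotProduct, Fin.sum_univ_four] <;> ring

theorem rigidMotion_apply (x a : Fin 4 → ℝ) :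
    rigidMotion x a = rotMatrix a *ᵥ x + ![0, 0, 0, a 3] := rfl

theorem inTSigma_rotMatrix (a : Fin 4 → ℝ) : InTSigma (rotMatrix a) ![0, 0, 0, a 3] := by
  refine ⟨?_, fun x _ => ?_⟩
  · ext i j
    fin_cases i <;> fin_cases j <;> simp [rotMatrix]
  · simp [piDot, rotMatrix, dotProduct, Fin.sum_univ_four]
    ring

theorem piDot_rigidMotion (a x : Fin 4 → ℝ) : piDot (rigidMotion x a) x = 0 := by
  simp [rigidMotion_apply, piDot, rotMatrix, dotProduct, Fin.sum_univ_four]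
  ring

theorem dot4_rigidMotion_sub (a x y : Fin 4 → ℝ) :
    dot4 (rigidMotion x a - rigidMotion y a) (x - y) = 0 := by
  simp [rigidMotion_apply, dot4, rotMatrix, dotProduct, Fin.sum_univ_four]
  ring

theorem InTSigma.exists_eq_rigidMotion {B : Matrix (Fin 4) (Fin 4) ℝ} {c : Fin 4 → ℝ}
    (h : InTSigma B c) : ∃ a, ∀ x, B *ᵥ x + c = rigidMotion x a := by
  obtain ⟨hB, h⟩ := h
  have hskew : ∀ i j, B j i = -B i j := fun i j => congrFun (congrFun hB i) j
  have d0 : B 0 0 = 0 := by linarith [hskew 0 0]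
  have d1 : B 1 1 = 0 := by linarith [hskew 1 1]
  have d2 : B 2 2 = 0 := by linarith [hskew 2 2]
  have d3 : B 3 3 = 0 := by linarith [hskew 3 3]
  have p0 := h ![1, 0, 0, 0] (by simp [Hyp])
  have p1 := h ![0, 1, 0, 0] (by simp [Hyp])
  have p2 := h ![0, 0, 1, 0] (by simp [Hyp])
  have r0 := h ![1, 0, 0, 1] (by simp [Hyp])
  have r1 := h ![0, 1, 0, 1] (by simp [Hyp])
  have r2 := h ![0, 0, 1, 1] (by simp [Hyp])
  simp [piDot, mulVec, dotProduct, Fin.sum_univ_four, d0, d1, d2] at p0 p1 p2 r0 r1 r2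
  simp only [p0, p1, p2, add_zero] at r0 r1 r2
  refine ⟨![B 2 1, B 0 2, B 1 0, c 3], fun x => ?_⟩
  ext i
  fin_cases i <;>
    simp [rigidMotion_apply, rotMatrix, mulVec, dotProduct, Fin.sum_univ_four, d0, d1, d2, d3,
      p0, p1, p2, r0, r1, r2, hskew 0 3, hskew 1 3, hskew 2 3, hskew 0 1, hskew 0 2, hskew 1 2]

theorem rotMatrix_eq_zero {a : Fin 4 → ℝ} (hB : rotMatrix a = 0)
    (hc : (![0, 0, 0, a 3] : Fin 4 → ℝ) = 0) : a = 0 := by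
  have h0 := congrFun (congrFun hB 2) 1
  have h1 := congrFun (congrFun hB 0) 2
  have h2 := congrFun (congrFun hB 1) 0
  have h3 := congrFun hc 3
  simp [rotMatrix] at h0 h1 h2 h3
  ext i
  fin_cases i <;> simp [h0, h1, h2, h3]

/-- The linear map sending a velocity assignment to its normal components at the vertices and its
edge-length derivatives along the edges with endpoints `s e` and `t e`. -/
def rigidityMap {W E : Type*} (q : W → Fin 4 → ℝ) (s t : E → W) :
    (W → Fin 4 → ℝ) →ₗ[ℝ] (W → ℝ) × (E → ℝ) where
  toFun m := (fun v => piDot (m v) (q v),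
    fun e => dot4 (m (s e) - m (t e)) (q (s e) - q (t e)))
  map_add' m n := by
    ext <;> simp [piDot, dot4, Fin.sum_univ_four] <;> ring
  map_smul' r m := by
    ext <;> simp [piDot, dot4, Fin.sum_univ_four] <;> ring

theorem rigidityMap_eq_zero_iff {W E : Type*} {q : W → Fin 4 → ℝ} {s t : E → W}
    {m : W → Fin 4 → ℝ} :
    rigidityMap q s t m = 0 ↔ (∀ v, piDot (m v) (q v) = 0) ∧
      ∀ e, dot4 (m (s e) - m (t e)) (q (s e) - q (t e)) = 0 := by
  simp [rigidityMap, Prod.ext_iff, funext_iff]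

/-- The evaluation of the infinitesimal rigid motions at the points of a placement. -/
def rigidMotions {W : Type*} (q : W → Fin 4 → ℝ) : (Fin 4 → ℝ) →ₗ[ℝ] (W → Fin 4 → ℝ) :=
  LinearMap.pi fun v => rigidMotion (q v)

theorem rigidMotions_apply {W : Type*} (q : W → Fin 4 → ℝ) (a : Fin 4 → ℝ) (v : W) :
    rigidMotions q a v = rigidMotion (q v) a := rfl

theorem card_add_le_of_surjective_rigidityMap {W E : Type*} [Fintype W] [Fintype E]
    {q : W → Fin 4 → ℝ} {s t : E → W} (hsurj : Function.Surjective (rigidityMap q s t))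
    (hfull : Function.Injective (rigidMotions q)) :
    Fintype.card E + 4 ≤ 3 * Fintype.card W := by
  have hrank := (rigidityMap q s t).finrank_range_add_finrank_ker
  rw [LinearMap.range_eq_top.2 hsurj, finrank_top] at hrank
  have hle : LinearMap.range (rigidMotions q) ≤ LinearMap.ker (rigidityMap q s t) := by
    rintro _ ⟨a, rfl⟩
    exact rigidityMap_eq_zero_iff.2
      ⟨fun v => piDot_rigidMotion a (q v), fun e => dot4_rigidMotion_sub a _ _⟩
  have hker := Submodule.finrank_mono hle
  rw [LinearMap.finrank_range_of_inj hfull] at hker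
  simp [Module.finrank_pi_fintype] at hrank hker
  omega

theorem le_card_add_of_ker_rigidityMap_le {W E : Type*} [Fintype W] [Fintype E]
    {q : W → Fin 4 → ℝ} {s t : E → W}
    (hker : LinearMap.ker (rigidityMap q s t) ≤ LinearMap.range (rigidMotions q)) :
    3 * Fintype.card W ≤ Fintype.card E + 4 := by
  have hrank := (rigidityMap q s t).finrank_range_add_finrank_ker
  have h1 := Submodule.finrank_le (LinearMap.range (rigidityMap q s t))
  have h2 := Submodule.finrank_mono hker
  have h3 := LinearMap.finrank_range_le (rigidMotions q)
  simp [Module.finrank_pi_fintype] at hrank h1 h3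
  omega

theorem dot4_out {V : Type*} (q m : V → Fin 4 → ℝ) {e : Sym2 V} {u v : V} (h : s(u, v) = e) :
    dot4 (m e.out.1 - m e.out.2) (q e.out.1 - q e.out.2) = dot4 (m u - m v) (q u - q v) := by
  have he : s(u, v) = s(e.out.1, e.out.2) := h.trans (Quot.out_eq e).symm
  rcases Sym2.eq_iff.1 he with ⟨h1, h2⟩ | ⟨h1, h2⟩
  · rw [← h1, ← h2]
  · rw [← h1, ← h2]
    simp only [dot4, Fin.sum_univ_four, Pi.sub_apply]
    ring

theorem isFlex_iff {V : Type*} {G : SimpleGraph V} {q m : V → Fin 4 → ℝ} :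
    IsFlex G q m ↔ (∀ e ∈ G.edgeSet,
      dot4 (m e.out.1 - m e.out.2) (q e.out.1 - q e.out.2) = 0) ∧
      ∀ v, piDot (m v) (q v) = 0 := by
  refine and_congr_left fun _ => ⟨fun h e he => ?_, fun h u v huv => ?_⟩
  · induction e with
    | h u v => rw [dot4_out q m rfl]; exact h u v he
  · rw [← dot4_out q m rfl]
    exact h s(u, v) huv

theorem exists_flex_of_not_infRigid_deleteEdges {V : Type*} {G : SimpleGraph V}
    {q : V → Fin 4 → ℝ} (hrigid : InfRigid G q) {e : Sym2 V}
    (hmin : ¬ InfRigid (G.deleteEdges {e}) q) :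
    ∃ m : V → Fin 4 → ℝ, (∀ v, piDot (m v) (q v) = 0) ∧
      dot4 (m e.out.1 - m e.out.2) (q e.out.1 - q e.out.2) = 1 ∧
      ∀ f ∈ G.edgeSet, f ≠ e → dot4 (m f.out.1 - m f.out.2) (q f.out.1 - q f.out.2) = 0 := by
  obtain ⟨m, hm⟩ := not_forall.1 hmin
  obtain ⟨hflex, hnt⟩ := Classical.not_imp.1 hm
  rw [isFlex_iff, SimpleGraph.edgeSet_deleteEdges] at hflex
  obtain ⟨hedge, hnormal⟩ := hflex
  set d := dot4 (m e.out.1 - m e.out.2) (q e.out.1 - q e.out.2) with hd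
  have hd0 : d ≠ 0 := by
    intro h0
    refine hnt (hrigid m (isFlex_iff.2 ⟨fun f hf => ?_, hnormal⟩))
    by_cases hfe : f = e
    · rw [hfe, ← hd, h0]
    · exact hedge f ⟨hf, hfe⟩
  have hscale : ∀ f : Sym2 V,
      dot4 ((d⁻¹ • m) f.out.1 - (d⁻¹ • m) f.out.2) (q f.out.1 - q f.out.2) =
        d⁻¹ * dot4 (m f.out.1 - m f.out.2) (q f.out.1 - q f.out.2) := by
    intro f
    simp only [dot4, Fin.sum_univ_four, Pi.sub_apply, Pi.smul_apply, smul_eq_mul]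
    ring
  refine ⟨d⁻¹ • m, fun v => ?_, ?_, fun f hf hfe => ?_⟩
  · have : piDot ((d⁻¹ • m) v) (q v) = d⁻¹ * piDot (m v) (q v) := by
      simp only [piDot, Pi.smul_apply, smul_eq_mul]
      ring
    rw [this, hnormal, mul_zero]
  · rw [hscale, ← hd, inv_mul_cancel₀ hd0]
  · rw [hscale, hedge f ⟨hf, hfe⟩, mul_zero]

theorem exists_piDot_eq {W : Type*} {q : W → Fin 4 → ℝ} (hq : ∀ v, q v ∈ Hyp) (r : W → ℝ) :
    ∃ m : W → Fin 4 → ℝ, ∀ v, piDot (m v) (q v) = r v := by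
  refine ⟨fun v => r v • q v, fun v => ?_⟩
  have h : q v 0 ^ 2 + q v 1 ^ 2 + q v 2 ^ 2 = 1 := hq v
  simp only [piDot, Pi.smul_apply, smul_eq_mul]
  linear_combination r v * h

theorem surjective_rigidityMap {W E : Type*} [Fintype E] {q : W → Fin 4 → ℝ} {s t : E → W}
    (hq : ∀ v, q v ∈ Hyp)
    (hdual : ∀ e, ∃ m : W → Fin 4 → ℝ, (∀ v, piDot (m v) (q v) = 0) ∧
      dot4 (m (s e) - m (t e)) (q (s e) - q (t e)) = 1 ∧
      ∀ f, f ≠ e → dot4 (m (s f) - m (t f)) (q (s f) - q (t f)) = 0) :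
    Function.Surjective (rigidityMap q s t) := by
  classical
  choose M hnormal hself hother using hdual
  have hM : ∀ e, rigidityMap q s t (M e) = (0, Pi.single e 1) := by
    intro e
    refine Prod.ext (funext fun v => hnormal e v) (funext fun f => ?_)
    by_cases hfe : f = e
    · subst hfe
      simpa [rigidityMap] using hself f
    · simpa [rigidityMap, hfe] using hother e f hfe
  rintro ⟨r, l⟩
  obtain ⟨m, hm⟩ := exists_piDot_eq hq r
  refine ⟨m + ∑ e, (l e - (rigidityMap q s t m).2 e) • M e, ?_⟩
  simp only [map_add, map_sum, map_smul, hM]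
  refine Prod.ext (funext fun v => ?_) (funext fun f => ?_)
  · simp only [Prod.fst_add, Prod.fst_sum, Prod.smul_fst, smul_zero, Finset.sum_const_zero,
      add_zero]
    exact hm v
  · simp [Prod.snd_sum, Pi.single_apply]

theorem card_le_choose_two {V : Type*} [DecidableEq V] {G : SimpleGraph V} {S : Finset V}
    {F : Finset (Sym2 V)} (hF : ↑F ⊆ G.edgeSet) (hS : ∀ e ∈ F, ∀ v ∈ e, v ∈ S) :
    F.card ≤ S.card.choose 2 := by
  rw [← Sym2.card_image_offDiag]
  refine Finset.card_le_card fun e he => ?_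
  induction e with
  | h u v =>
    have huv : G.Adj u v := hF he
    exact Finset.mem_image.2 ⟨(u, v), Finset.mem_offDiag.2
      ⟨hS _ he u (Sym2.mem_mk_left u v), hS _ he v (Sym2.mem_mk_right u v), huv.ne⟩, rfl⟩

theorem card_add_four_le {V : Type*} {G : SimpleGraph V} {q : V → Fin 4 → ℝ}
    (hq : ∀ v, q v ∈ Hyp) (hrigid : InfRigid G q)
    (hmin : ∀ e ∈ G.edgeSet, ¬ InfRigid (G.deleteEdges {e}) q)
    {S : Finset V} (hfull : FullOn q ↑S) {F : Finset (Sym2 V)} (hF : ↑F ⊆ G.edgeSet)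
    (hS : ∀ e ∈ F, ∀ v ∈ e, v ∈ S) : F.card + 4 ≤ 3 * S.card := by
  have hsurj : Function.Surjective (rigidityMap (fun v : S => q v)
      (fun e : F => (⟨e.1.out.1, hS e.1 e.2 _ (Sym2.out_fst_mem e.1)⟩ : S))
      (fun e : F => (⟨e.1.out.2, hS e.1 e.2 _ (Sym2.out_snd_mem e.1)⟩ : S))) := by
    refine surjective_rigidityMap (fun v => hq v) fun e => ?_
    obtain ⟨m, hnormal, hself, hother⟩ :=
      exists_flex_of_not_infRigid_deleteEdges hrigid (hmin e (hF e.2))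
    exact ⟨fun v => m v, fun v => hnormal v, hself,
      fun f hfe => hother f (hF f.2) (Subtype.coe_injective.ne hfe)⟩
  have hinj : Function.Injective (rigidMotions fun v : S => q v) := by
    refine (injective_iff_map_eq_zero _).2 fun a ha => ?_
    obtain ⟨hB, hc⟩ := hfull _ _ (inTSigma_rotMatrix a) fun v hv => congrFun ha ⟨v, hv⟩
    exact rotMatrix_eq_zero hB hc
  simpa using card_add_le_of_surjective_rigidityMap hsurj hinj

theorem InfRigid.le_ncard_edgeSet_add_four {V : Type*} [Fintype V] {G : SimpleGraph V}
    {q : V → Fin 4 → ℝ} (hrigid : InfRigid G q) :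
    3 * Fintype.card V ≤ G.edgeSet.ncard + 4 := by
  classical
  rw [← Nat.card_coe_set_eq, Nat.card_eq_fintype_card]
  refine le_card_add_of_ker_rigidityMap_le (q := q) (s := fun e : G.edgeSet => e.1.out.1)
    (t := fun e => e.1.out.2) fun m hm => ?_
  obtain ⟨hnormal, hedge⟩ := rigidityMap_eq_zero_iff.1 hm
  obtain ⟨B, c, hBc, hm⟩ := hrigid m (isFlex_iff.2 ⟨fun e he => hedge ⟨e, he⟩, hnormal⟩)
  obtain ⟨a, ha⟩ := hBc.exists_eq_rigidMotion
  exact ⟨a, funext fun v => (ha (q v)).symm.trans (hm v).symm⟩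

theorem stmt4 {V : Type*} [Fintype V] [DecidableEq V] (G : SimpleGraph V)
    (hV : 6 ≤ Fintype.card V) (q : V → Fin 4 → ℝ) (hq : ∀ v, q v ∈ Hyp)
    (hcf : ∀ S : Finset V, 6 ≤ S.card → FullOn q ↑S)
    (hrigid : InfRigid G q)
    (hmin : ∀ e ∈ G.edgeSet, ¬ InfRigid (G.deleteEdges {e}) q) :
    (G.edgeSet.ncard : ℤ) = 3 * Fintype.card V - 4 ∧
      ∀ (V' : Finset V) (E' : Finset (Sym2 V)), ↑E' ⊆ G.edgeSet →
        (∀ e ∈ E', ∀ v ∈ e, v ∈ V') → E'.Nonempty →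
          (E'.card : ℤ) ≤ 3 * V'.card - 4 := by
  classical
  refine ⟨?_, fun V' E' hE' hV' hne => ?_⟩
  · have hge := hrigid.le_ncard_edgeSet_add_four
    have hle := card_add_four_le hq hrigid hmin (S := Finset.univ) (F := G.edgeFinset)
      (hcf _ (by simpa using hV)) (by simp) (by simp)
    rw [← SimpleGraph.coe_edgeFinset, Set.ncard_coe_finset] at hge ⊢
    rw [Finset.card_univ] at hle
    omega
  · by_cases h6 : 6 ≤ V'.card
    · have := card_add_four_le hq hrigid hmin (hcf V' h6) hE' hV'
      omega
    · have hle := card_le_choose_two hE' hV'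
      have hpos := hne.card_pos
      have hlt : V'.card < 6 := not_le.1 h6
      generalize V'.card = n at hle hlt ⊢
      rw [Nat.choose_two_right] at hle
      interval_cases n <;> omega
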